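/- arXiv:1705.08196 — 2 statements merged into one kernel-verified Lean document; each statement's English description precedes it below -/
import Mathlib

section
/- Let G be a finitely generated group of polynomial growth and let S be a finite symmetric generating set containing the identity. Then for every k ∈ ℕ, the space of functions f : G → ℝ that are harmonic with respect to the uniform measure on S (i.e. f(x) = (1/|S|)·Σ_{s∈S} f(xs) for all x) and satisfy |f(x)| ≤ c(1+|x|_S)^k for some c > 0, is finite-dimensional. -/
open Pointwise

noncomputable section

/-- Word norm with respect to a generating set `S`: the least `n` with `x ∈ Sⁿ`. -/
def wordNorm {G : Type*} [Group G] (S : Set G) (x : G) : ℕ :=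
  sInf {n : ℕ | x ∈ S ^ n}

section GramDeterminant

open Matrix
open scoped MatrixOrder

variable {n : Type*} [Fintype n] [DecidableEq n]

lemma exists_simultaneous_diagonalization {A B : Matrix n n ℝ} (hA : A.IsHermitian)
    (hB : B.PosDef) :
    ∃ (K : Matrix n n ℝ) (l : n → ℝ), Kᵀ * B * K = 1 ∧ Kᵀ * A * K = diagonal l := by
  obtain ⟨Y, hY⟩ := CStarAlgebra.nonneg_iff_eq_star_mul_self.mp hB.posSemidef.nonneg
  have hYB : B = Yᵀ * Y := by simpa [star_eq_conjTranspose] using hY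
  have hYdet : IsUnit Y.det := by
    have h := hB.det_pos.ne'
    rw [hYB, det_mul, det_transpose] at h
    exact isUnit_iff_ne_zero.mpr (left_ne_zero_of_mul h)
  have hA' : (Y⁻¹ᵀ * A * Y⁻¹).IsHermitian := by
    simpa using isHermitian_conjTranspose_mul_mul Y⁻¹ hA
  set U : Matrix n n ℝ := (hA'.eigenvectorUnitary : unitaryGroup n ℝ).1 with hU
  have hUU : Uᵀ * U = 1 := by
    simpa [star_eq_conjTranspose] using Unitary.coe_star_mul_self hA'.eigenvectorUnitary
  refine ⟨Y⁻¹ * U, hA'.eigenvalues, ?_, ?_⟩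
  · calc (Y⁻¹ * U)ᵀ * B * (Y⁻¹ * U) = Uᵀ * (Y * Y⁻¹)ᵀ * (Y * Y⁻¹) * U := by
          rw [hYB]; simp only [transpose_mul, Matrix.mul_assoc]
      _ = 1 := by rw [mul_nonsing_inv _ hYdet]; simpa using hUU
  · have h := hA'.conjStarAlgAut_star_eigenvectorUnitary
    rw [Unitary.conjStarAlgAut_star_apply, star_eq_conjTranspose,
      conjTranspose_eq_transpose_of_trivial, ← hU] at h
    simp only [transpose_mul, Matrix.mul_assoc] at h ⊢
    simpa [Function.comp_def] using h

lemma det_le_pow_mul_det {A B : Matrix n n ℝ} (hA : A.PosSemidef) (hB : B.PosDef)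
    (hAB : ∀ c : n → ℝ, c ⬝ᵥ A *ᵥ c ≤ c ⬝ᵥ B *ᵥ c) {m : Type*} [Fintype m]
    (L : (n → ℝ) →ₗ[ℝ] (m → ℝ)) {δ : ℝ} (hδ0 : 0 ≤ δ) (hδ1 : δ ≤ 1)
    (hL : ∀ c, L c = 0 → c ⬝ᵥ A *ᵥ c ≤ δ * (c ⬝ᵥ B *ᵥ c)) :
    A.det ≤ δ ^ (Fintype.card n - Fintype.card m) * B.det := by
  obtain ⟨K, l, hKB, hKA⟩ := exists_simultaneous_diagonalization hA.1 hB
  have quadA (c : n → ℝ) : (K *ᵥ c) ⬝ᵥ A *ᵥ (K *ᵥ c) = ∑ i, l i * c i ^ 2 := by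
    have : (K *ᵥ c) ⬝ᵥ A *ᵥ (K *ᵥ c) = c ⬝ᵥ (Kᵀ * A * K) *ᵥ c := by
      simp only [← mulVec_mulVec, dotProduct_mulVec, vecMul_transpose]
    rw [this, hKA]
    simp only [dotProduct, mulVec_diagonal]
    exact Finset.sum_congr rfl fun i _ => by ring
  have quadB (c : n → ℝ) : (K *ᵥ c) ⬝ᵥ B *ᵥ (K *ᵥ c) = ∑ i, c i ^ 2 := by
    have : (K *ᵥ c) ⬝ᵥ B *ᵥ (K *ᵥ c) = c ⬝ᵥ (Kᵀ * B * K) *ᵥ c := by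
      simp only [← mulVec_mulVec, dotProduct_mulVec, vecMul_transpose]
    rw [this, hKB]
    simp only [dotProduct, one_mulVec]
    exact Finset.sum_congr rfl fun i _ => by ring
  have l0 (i : n) : 0 ≤ l i := by
    have h := hA.dotProduct_mulVec_nonneg (K *ᵥ Pi.single i 1)
    rw [star_trivial, quadA] at h
    simpa [Pi.single_apply] using h
  have l1 (i : n) : l i ≤ 1 := by
    have h := hAB (K *ᵥ Pi.single i 1)
    rw [quadA, quadB] at h
    simpa [Pi.single_apply] using h
  have hdetB : K.det * K.det * B.det = 1 := by
    have := congrArg det hKB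
    simp only [det_mul, det_transpose, det_one] at this
    linarith
  have hdetA : K.det * K.det * A.det = ∏ i, l i := by
    have := congrArg det hKA
    simp only [det_mul, det_transpose, det_diagonal] at this
    linarith
  set J : Finset n := Finset.univ.filter fun i => δ < l i with hJ
  have hJcard : J.card ≤ Fintype.card m := by
    by_contra! hlt
    let E : (J → ℝ) →ₗ[ℝ] (n → ℝ) := Function.ExtendByZero.linearMap ℝ (Subtype.val : J → n)
    have hE (c : J → ℝ) (j : J) : E c j = c j := by
      exact Subtype.val_injective.extend_apply c (0 : n → ℝ) j
    have hE0 (c : J → ℝ) (i : n) (hi : i ∉ J) : E c i = 0 := by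
      refine Function.extend_apply' c (0 : n → ℝ) i ?_
      rintro ⟨j, rfl⟩
      exact hi j.2
    have hker : (L ∘ₗ K.mulVecLin ∘ₗ E).ker ≠ ⊥ := by
      apply LinearMap.ker_ne_bot_of_finrank_lt
      simpa using hlt
    obtain ⟨c, hc, hc0⟩ := (Submodule.ne_bot_iff _).mp hker
    have h := hL (K *ᵥ E c) (by simpa using hc)
    rw [quadA, quadB, Finset.mul_sum] at h
    obtain ⟨j, hj⟩ := Function.ne_iff.mp hc0
    refine h.not_gt (Finset.sum_lt_sum (fun i _ => ?_) ⟨j, Finset.mem_univ _, ?_⟩)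
    · by_cases hi : i ∈ J
      · exact mul_le_mul_of_nonneg_right (Finset.mem_filter.mp hi).2.le (sq_nonneg _)
      · simp [hE0 c i hi]
    · rw [hE]
      have : c j ≠ 0 := hj
      exact mul_lt_mul_of_pos_right (Finset.mem_filter.mp j.2).2 (by positivity)
  have hprod : ∏ i, l i ≤ δ ^ (Fintype.card n - Fintype.card m) := by
    rw [← Finset.prod_mul_prod_compl J]
    calc (∏ i ∈ J, l i) * ∏ i ∈ Jᶜ, l i ≤ 1 * ∏ _i ∈ Jᶜ, δ := by
          gcongr
          · exact Finset.prod_nonneg fun i _ => l0 i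
          · exact Finset.prod_le_one (fun i _ => l0 i) fun i _ => l1 i
          · exact fun i _ => l0 i
          · rename_i i hi
            simpa [hJ] using hi
      _ = δ ^ (Fintype.card n - J.card) := by simp [Finset.card_compl]
      _ ≤ _ := pow_le_pow_of_le_one hδ0 hδ1 (by omega)
  calc A.det = (K.det * K.det * A.det) * B.det := by linear_combination (-A.det) * hdetB
    _ ≤ _ := by
      rw [hdetA]
      exact mul_le_mul_of_nonneg_right hprod hB.det_pos.le

lemma det_le_trace_pow {A : Matrix n n ℝ} (hA : A.PosSemidef) :
    A.det ≤ A.trace ^ Fintype.card n := by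
  rw [hA.1.det_eq_prod_eigenvalues, hA.1.trace_eq_sum_eigenvalues]
  simp only [RCLike.ofReal_real_eq_id, id]
  calc ∏ i, hA.1.eigenvalues i ≤ ∏ _i : n, ∑ j, hA.1.eigenvalues j :=
        Finset.prod_le_prod (fun i _ => hA.eigenvalues_nonneg i) fun i _ =>
          Finset.single_le_sum (fun j _ => hA.eigenvalues_nonneg j) (Finset.mem_univ i)
    _ = _ := by simp

end GramDeterminant

section ScaleSelection

lemma exists_step_le_of_le_pow {u : ℕ → ℝ} {T : ℝ} (hT : 0 ≤ T) {a w : ℕ} (hw : 1 ≤ w)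
    (h : u (a + w) ≤ T ^ w * u a) : ∃ j < w, u (a + j + 1) ≤ T * u (a + j) := by
  by_contra! hcon
  have hle : ∀ j < w, T ^ j * u a ≤ u (a + j) := by
    intro j
    induction j with
    | zero => simp
    | succ j ih =>
      intro hj
      calc T ^ (j + 1) * u a = T * (T ^ j * u a) := by ring
        _ ≤ T * u (a + j) := by gcongr; exact ih (by omega)
        _ ≤ u (a + (j + 1)) := (hcon j (by omega)).le
  obtain ⟨v, rfl⟩ : ∃ v, w = v + 1 := ⟨w - 1, by omega⟩
  have h1 := hcon v (by omega)
  have h2 := mul_le_mul_of_nonneg_left (hle v (by omega)) hT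
  rw [pow_succ] at h
  rw [← add_assoc] at h
  linarith

lemma exists_window_le {u : ℕ → ℝ} {C q Q : ℝ} {i₀ : ℕ} (hq : 0 < q) (hQ : 2 * q ≤ Q)
    (hpos : ∀ i ≥ i₀, 0 < u i) (hu : ∀ i, u i ≤ C * q ^ i) {w : ℕ} (hw : 1 ≤ w) :
    ∃ a ≥ i₀, u (a + w) ≤ Q ^ w * u a := by
  by_contra! hcon
  have hQ0 : 0 < Q := by linarith
  have hle : ∀ m : ℕ, (Q ^ w) ^ m * u i₀ ≤ u (i₀ + w * m) := by
    intro m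
    induction m with
    | zero => simp
    | succ m ih =>
      calc (Q ^ w) ^ (m + 1) * u i₀ = Q ^ w * ((Q ^ w) ^ m * u i₀) := by ring
        _ ≤ Q ^ w * u (i₀ + w * m) := by gcongr
        _ ≤ u (i₀ + w * (m + 1)) := 
          (hcon (i₀ + w * m) (by omega)).le.trans_eq (by rw [mul_add_one, add_assoc])
  have hu0 := hpos i₀ le_rfl
  obtain ⟨m, hm⟩ := pow_unbounded_of_one_lt (C * q ^ i₀ / u i₀) (one_lt_two (α := ℝ))
  rw [div_lt_iff₀ hu0] at hm
  have h1 := (hle m).trans (hu _)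
  have h2 : (2 * q) ^ (w * m) ≤ (Q ^ w) ^ m := by
    rw [← pow_mul]
    gcongr
  have h3 : (2 : ℝ) ^ m ≤ 2 ^ (w * m) :=
    pow_le_pow_right₀ one_le_two (Nat.le_mul_of_pos_left m hw)
  have h4 : (2 : ℝ) ^ m * u i₀ * q ^ (w * m) ≤ C * q ^ i₀ * q ^ (w * m) := by
    calc (2 : ℝ) ^ m * u i₀ * q ^ (w * m) ≤ 2 ^ (w * m) * u i₀ * q ^ (w * m) := by gcongr
      _ = (2 * q) ^ (w * m) * u i₀ := by rw [mul_pow]; ring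
      _ ≤ (Q ^ w) ^ m * u i₀ := by gcongr
      _ ≤ _ := h1
      _ = _ := by rw [pow_add]; ring
  exact (le_of_mul_le_mul_right h4 (by positivity)).not_gt hm

/-- An eventually positive and monotone sequence of at most exponential growth has long windows
in which it grows slowly overall and also at some step near either end. -/
lemma exists_slow_scales {u : ℕ → ℝ} {C q Q : ℝ} {i₀ : ℕ} (hq : 0 < q) (hQ : 2 * q ≤ Q)
    (hpos : ∀ i ≥ i₀, 0 < u i) (hmono : ∀ i ≥ i₀, u i ≤ u (i + 1)) (hu : ∀ i, u i ≤ C * q ^ i)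
    {w : ℕ} (hw : 1 ≤ w) :
    ∃ a i j, i₀ ≤ a ∧ a ≤ i ∧ i + w < j ∧ j + 1 ≤ a + 3 * w ∧ u (i + 1) ≤ Q ^ 3 * u i ∧
      u (j + 1) ≤ Q ^ 3 * u j ∧ u (a + 3 * w) ≤ (Q ^ 3) ^ w * u a := by
  have hQ0 : 0 < Q := by linarith
  obtain ⟨a, ha, hua⟩ := exists_window_le hq hQ hpos hu (by omega : 1 ≤ 3 * w)
  rw [pow_mul] at hua
  have hmono' : ∀ {m n : ℕ}, a ≤ m → m ≤ n → u m ≤ u n := fun {m n} ham hmn => by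
    induction n, hmn using Nat.le_induction with
    | base => exact le_rfl
    | succ n hmn ih => exact ih.trans (hmono n (by omega))
  obtain ⟨i, hi, hui⟩ := exists_step_le_of_le_pow (u := u) (a := a) (w := w)
    (by positivity : 0 ≤ Q ^ 3) hw ((hmono' (by omega) (by omega)).trans hua)
  obtain ⟨j, hj, huj⟩ := exists_step_le_of_le_pow (u := u) (a := a + 2 * w) (w := w)
    (by positivity : 0 ≤ Q ^ 3) hw (by
      rw [show a + 2 * w + w = a + 3 * w by ring]
      exact hua.trans (mul_le_mul_of_nonneg_left (hmono' le_rfl (by omega)) (by positivity)))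
  exact ⟨a, a + i, a + 2 * w + j, ha, by omega, by omega, by omega, hui, huj, hua⟩

end ScaleSelection

section GramMatrix

open Matrix

variable {α ι : Type*} [Fintype ι]

/-- The Gram matrix of a family of functions in the `ℓ²` inner product on a finite set. -/
def gramOn (F : Finset α) (b : ι → α → ℝ) : Matrix ι ι ℝ :=
  Matrix.of fun i j => ∑ x ∈ F, b i x * b j x

lemma dotProduct_gramOn_mulVec (F : Finset α) (b : ι → α → ℝ) (c : ι → ℝ) :
    c ⬝ᵥ gramOn F b *ᵥ c = ∑ x ∈ F, (∑ i, c i * b i x) ^ 2 := by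
  simp only [sq, Finset.sum_mul_sum]
  rw [Finset.sum_comm]
  simp only [dotProduct, mulVec, gramOn, of_apply, Finset.mul_sum, Finset.sum_mul]
  refine Finset.sum_congr rfl fun i _ => ?_
  rw [Finset.sum_comm]
  exact Finset.sum_congr rfl fun x _ => Finset.sum_congr rfl fun j _ => by ring

lemma gramOn_posSemidef (F : Finset α) (b : ι → α → ℝ) : (gramOn F b).PosSemidef := by
  refine .of_dotProduct_mulVec_nonneg ?_ fun c => ?_
  · ext i j
    simp [gramOn, mul_comm]
  · rw [star_trivial, dotProduct_gramOn_mulVec]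
    exact Finset.sum_nonneg fun _ _ => sq_nonneg _

lemma gramOn_posDef {F : Finset α} {b : ι → α → ℝ}
    (h : ∀ c : ι → ℝ, (∀ x ∈ F, ∑ i, c i * b i x = 0) → c = 0) : (gramOn F b).PosDef := by
  refine .of_dotProduct_mulVec_pos (gramOn_posSemidef F b).1 fun c hc => ?_
  rw [star_trivial, dotProduct_gramOn_mulVec]
  refine (Finset.sum_nonneg fun _ _ => sq_nonneg _).lt_of_ne' fun h0 => hc (h c fun x hx => ?_)
  rw [Finset.sum_eq_zero_iff_of_nonneg fun _ _ => sq_nonneg _] at h0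
  exact pow_eq_zero_iff two_ne_zero |>.mp (h0 x hx)

lemma exists_forall_gramOn_posDef {b : ι → α → ℝ} (hb : LinearIndependent ℝ b)
    {F : ℕ → Finset α} (hF : Monotone F) (hcover : ∀ x, ∃ n, x ∈ F n) :
    ∃ n₀, ∀ n ≥ n₀, (gramOn (F n) b).PosDef := by
  let K : ℕ →o (Submodule ℝ (ι → ℝ))ᵒᵈ :=
    { toFun := fun n => OrderDual.toDual
        { carrier := {c | ∀ x ∈ F n, ∑ i, c i * b i x = 0}
          zero_mem' := by simp
          add_mem' := fun {c d} hc hd x hx => by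
            simp [add_mul, Finset.sum_add_distrib, hc x hx, hd x hx]
          smul_mem' := fun t c hc x hx => by
            simp [mul_assoc, ← Finset.mul_sum, hc x hx] }
      monotone' := fun m n hmn c hc x hx => hc x (hF hmn hx) }
  obtain ⟨n₀, hn₀⟩ := IsArtinian.monotone_stabilizes K
  refine ⟨n₀, fun n hn => gramOn_posDef fun c hc => ?_⟩
  have hzero : ∀ x, ∑ i, c i * b i x = 0 := fun x => by
    obtain ⟨m, hm⟩ := hcover x
    have hcn : c ∈ OrderDual.ofDual (K n) := hc
    rw [← hn₀ n hn, hn₀ (max n₀ m) (le_max_left _ _)] at hcn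
    exact hcn x (hF (le_max_right _ _) hm)
  funext i
  refine Fintype.linearIndependent_iff.mp hb c (funext fun x => ?_) i
  simpa using hzero x

lemma det_gramOn_mono [DecidableEq ι] {F F' : Finset α} (hF : F ⊆ F') {b : ι → α → ℝ}
    (hF' : (gramOn F' b).PosDef) : (gramOn F b).det ≤ (gramOn F' b).det := by
  have hle : ∀ c : ι → ℝ, c ⬝ᵥ gramOn F b *ᵥ c ≤ c ⬝ᵥ gramOn F' b *ᵥ c := fun c => by
    simp only [dotProduct_gramOn_mulVec]
    exact Finset.sum_le_sum_of_subset_of_nonneg hF fun _ _ _ => sq_nonneg _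
  simpa using det_le_pow_mul_det (gramOn_posSemidef F b) hF' hle
    (0 : (ι → ℝ) →ₗ[ℝ] (Fin 0 → ℝ)) zero_le_one le_rfl fun c _ => by simpa using hle c

end GramMatrix

section WordBalls

variable {G : Type*} [Group G] {S : Finset G}

/-- The squared length of the discrete gradient of `f` at `x`. -/
def gradSq (S : Finset G) (f : G → ℝ) (x : G) : ℝ := ∑ s ∈ S, (f (x * s) - f x) ^ 2

lemma gradSq_nonneg (S : Finset G) (f : G → ℝ) (x : G) : 0 ≤ gradSq S f x :=
  Finset.sum_nonneg fun _ _ => sq_nonneg _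

variable [DecidableEq G]

lemma mem_pow_iff_wordNorm_le (hone : (1 : G) ∈ S) (hgen : ∀ x : G, ∃ n : ℕ, x ∈ (S : Set G) ^ n)
    {x : G} {n : ℕ} : x ∈ S ^ n ↔ wordNorm (S : Set G) x ≤ n := by
  constructor
  · intro h
    exact Nat.sInf_le (by simpa [← Finset.coe_pow] using h)
  · intro h
    have hx : x ∈ (S : Set G) ^ wordNorm (S : Set G) x := Nat.sInf_mem (hgen x)
    rw [← Finset.coe_pow, Finset.mem_coe] at hx
    exact Finset.pow_subset_pow_right hone h hx

lemma inv_mem_pow (hinv : S⁻¹ = S) {x : G} {n : ℕ} (hx : x ∈ S ^ n) : x⁻¹ ∈ S ^ n := by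
  rw [← hinv, inv_pow]
  exact Finset.inv_mem_inv hx

lemma inv_mem_pow_iff (hinv : S⁻¹ = S) {x : G} {n : ℕ} : x⁻¹ ∈ S ^ n ↔ x ∈ S ^ n :=
  ⟨fun h => inv_inv x ▸ inv_mem_pow hinv h, inv_mem_pow hinv⟩

lemma mul_mem_pow {x y : G} {m n : ℕ} (hx : x ∈ S ^ m) (hy : y ∈ S ^ n) :
    x * y ∈ S ^ (m + n) := pow_add S m n ▸ Finset.mul_mem_mul hx hy

lemma wordNorm_mul_le (hone : (1 : G) ∈ S) (hgen : ∀ x : G, ∃ n : ℕ, x ∈ (S : Set G) ^ n)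
    (x : G) {s : G} (hs : s ∈ S) :
    wordNorm (S : Set G) (x * s) ≤ wordNorm (S : Set G) x + 1 :=
  (mem_pow_iff_wordNorm_le hone hgen).mp <|
    mul_mem_pow ((mem_pow_iff_wordNorm_le hone hgen).mpr le_rfl) (by simpa using hs)

lemma wordNorm_le_wordNorm_mul (hinv : S⁻¹ = S) (hone : (1 : G) ∈ S)
    (hgen : ∀ x : G, ∃ n : ℕ, x ∈ (S : Set G) ^ n) (x : G) {s : G} (hs : s ∈ S) :
    wordNorm (S : Set G) x ≤ wordNorm (S : Set G) (x * s) + 1 := by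
  have hs' : s⁻¹ ∈ S := by rw [← hinv]; exact Finset.inv_mem_inv hs
  simpa using wordNorm_mul_le hone hgen (x * s) hs'

lemma sum_pow_mul_right_le {h : G → ℝ} (hh : ∀ x, 0 ≤ h x) (m : ℕ) {n : ℕ} {g : G}
    (hg : g ∈ S ^ n) : ∑ x ∈ S ^ m, h (x * g) ≤ ∑ x ∈ S ^ (m + n), h x := by
  rw [← Finset.sum_image (f := h) (g := fun x => x * g) fun x _ y _ hxy => mul_right_cancel hxy]
  refine Finset.sum_le_sum_of_subset_of_nonneg ?_ fun x _ _ => hh x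
  intro y hy
  obtain ⟨x, hx, rfl⟩ := Finset.mem_image.mp hy
  exact mul_mem_pow hx hg

lemma sum_pow_mono (hone : (1 : G) ∈ S) {h : G → ℝ} (hh : ∀ x, 0 ≤ h x) {m n : ℕ} (hmn : m ≤ n) :
    ∑ x ∈ S ^ m, h x ≤ ∑ x ∈ S ^ n, h x :=
  Finset.sum_le_sum_of_subset_of_nonneg (Finset.pow_subset_pow_right hone hmn) fun x _ _ => hh x

lemma sum_pow_mul_right_eq (hinv : S⁻¹ = S) (hone : (1 : G) ∈ S) {h : G → ℝ} {n : ℕ}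
    (hh : ∀ x ∉ S ^ n, h x = 0) {s : G} (hs : s ∈ S) :
    ∑ x ∈ S ^ (n + 1), h (x * s) = ∑ x ∈ S ^ (n + 1), h x := by
  have h1 : ∑' x, h (x * s) = ∑ x ∈ S ^ (n + 1), h (x * s) := by
    refine tsum_eq_sum fun x hx => hh _ fun hxs => hx ?_
    have hs' : s⁻¹ ∈ S ^ 1 := inv_mem_pow hinv (by simpa using hs)
    simpa using mul_mem_pow hxs hs'
  have h2 : ∑' x, h x = ∑ x ∈ S ^ (n + 1), h x :=
    tsum_eq_sum fun x hx => hh _ fun hxs =>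
      hx (Finset.pow_subset_pow_right hone n.le_succ hxs)
  rw [← h1, ← h2]
  exact Equiv.tsum_eq (Equiv.mulRight s) h

/-- Discrete Caccioppoli (reverse Poincaré) inequality. -/
lemma sum_gradSq_le (hinv : S⁻¹ = S) (hone : (1 : G) ∈ S)
    (hgen : ∀ x : G, ∃ n : ℕ, x ∈ (S : Set G) ^ n) {f : G → ℝ}
    (hf : ∀ x, ∑ s ∈ S, (f (x * s) - f x) = 0) {R : ℕ} (hR : 1 ≤ R) :
    (R : ℝ) ^ 2 * ∑ x ∈ S ^ R, gradSq S f x ≤ 9 / 2 * S.card * ∑ x ∈ S ^ (4 * R), f x ^ 2 := by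
  set p : G → ℝ := fun x => ((min R (2 * R - wordNorm (S : Set G) x) : ℕ) : ℝ) with hp
  have hp_eq : ∀ x ∈ S ^ R, p x = R := fun x hx => by
    have := (mem_pow_iff_wordNorm_le hone hgen).mp hx
    simp only [hp, Nat.cast_inj]
    omega
  have hp_zero : ∀ x ∉ S ^ (2 * R), p x = 0 := fun x hx => by
    rw [mem_pow_iff_wordNorm_le hone hgen] at hx
    simp only [hp, Nat.cast_eq_zero]
    omega
  have hp_lip : ∀ x, ∀ s ∈ S, (p x - p (x * s)) ^ 2 ≤ 1 := fun x s hs => by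
    have h1 := wordNorm_mul_le hone hgen x hs
    have h2 := wordNorm_le_wordNorm_mul hinv hone hgen x hs
    have h3 : min R (2 * R - wordNorm (S : Set G) x) ≤
      min R (2 * R - wordNorm (S : Set G) (x * s)) + 1 := by omega
    have h4 : min R (2 * R - wordNorm (S : Set G) (x * s)) ≤
      min R (2 * R - wordNorm (S : Set G) x) + 1 := by omega
    have h3' : p x ≤ p (x * s) + 1 := by simp only [hp]; exact_mod_cast h3
    have h4' : p (x * s) ≤ p x + 1 := by simp only [hp]; exact_mod_cast h4
    rw [sq_le_one_iff_abs_le_one, abs_le]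
    constructor <;> linarith
  have hpt : ∀ x, ∀ s ∈ S, p x ^ 2 * (f (x * s) - f x) ^ 2 ≤
      2 * (p (x * s) ^ 2 * f (x * s) * (f (x * s) - f x)) -
        2 * (p x ^ 2 * f x * (f (x * s) - f x)) + (4 * f (x * s) ^ 2 + 1 / 2 * f x ^ 2) := by
    intro x s hs
    have h := mul_le_mul_of_nonneg_right (hp_lip x s hs)
      (by positivity : 0 ≤ 4 * f (x * s) ^ 2 + 1 / 2 * f x ^ 2)
    nlinarith [sq_nonneg (p x * (f (x * s) - f x) - 2 * (p x - p (x * s)) * f (x * s)),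
      sq_nonneg ((p x - p (x * s)) * (f (x * s) - f x / 2))]
  have hzero1 : ∑ x ∈ S ^ (2 * R + 1), ∑ s ∈ S, p x ^ 2 * f x * (f (x * s) - f x) = 0 :=
    Finset.sum_eq_zero fun x _ => by rw [← Finset.mul_sum, hf, mul_zero]
  have hzero2 : ∑ x ∈ S ^ (2 * R + 1), ∑ s ∈ S,
      p (x * s) ^ 2 * f (x * s) * (f (x * s) - f x) = 0 := by
    have hshift : ∀ s ∈ S, ∑ x ∈ S ^ (2 * R + 1), p (x * s) ^ 2 * f (x * s) * (f (x * s) - f x) =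
        ∑ x ∈ S ^ (2 * R + 1), p x ^ 2 * f x * (f x - f (x * s⁻¹)) := fun s hs => by
      rw [← sum_pow_mul_right_eq hinv hone (h := fun x => p x ^ 2 * f x * (f x - f (x * s⁻¹)))
        (fun x hx => by simp [hp_zero x hx]) hs]
      simp
    rw [Finset.sum_comm, Finset.sum_congr rfl hshift, Finset.sum_comm]
    refine Finset.sum_eq_zero fun x _ => ?_
    have hx : ∑ s ∈ S, (f x - f (x * s⁻¹)) = 0 := by
      have hsum : ∑ s ∈ S, (f x - f (x * s⁻¹)) = ∑ s ∈ S, (f x - f (x * s)) := by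
        conv_rhs => rw [← hinv]
        rw [← Finset.image_inv_eq_inv, Finset.sum_image inv_injective.injOn]
      rw [hsum, ← neg_eq_zero, ← Finset.sum_neg_distrib, ← hf x]
      exact Finset.sum_congr rfl fun s _ => by ring
    rw [← Finset.mul_sum, hx, mul_zero]
  have hsq : ∀ x, 0 ≤ f x ^ 2 := fun x => sq_nonneg _
  calc (R : ℝ) ^ 2 * ∑ x ∈ S ^ R, gradSq S f x = ∑ x ∈ S ^ R, p x ^ 2 * gradSq S f x := by
        rw [Finset.mul_sum]
        exact Finset.sum_congr rfl fun x hx => by rw [hp_eq x hx]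
    _ ≤ ∑ x ∈ S ^ (2 * R + 1), p x ^ 2 * gradSq S f x :=
        sum_pow_mono hone (fun x => mul_nonneg (sq_nonneg _) (gradSq_nonneg S f x)) (by omega)
    _ = ∑ x ∈ S ^ (2 * R + 1), ∑ s ∈ S, p x ^ 2 * (f (x * s) - f x) ^ 2 := by
        simp only [gradSq, Finset.mul_sum]
    _ ≤ ∑ x ∈ S ^ (2 * R + 1), ∑ s ∈ S, (2 * (p (x * s) ^ 2 * f (x * s) * (f (x * s) - f x)) -
        2 * (p x ^ 2 * f x * (f (x * s) - f x)) + (4 * f (x * s) ^ 2 + 1 / 2 * f x ^ 2)) :=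
        Finset.sum_le_sum fun x _ => Finset.sum_le_sum fun s hs => hpt x s hs
    _ = ∑ x ∈ S ^ (2 * R + 1), ∑ s ∈ S, (4 * f (x * s) ^ 2 + 1 / 2 * f x ^ 2) := by
        have hsplit : ∀ a b c : G → G → ℝ, ∑ x ∈ S ^ (2 * R + 1), ∑ s ∈ S,
            (2 * a x s - 2 * b x s + c x s) = 2 * ∑ x ∈ S ^ (2 * R + 1), ∑ s ∈ S, a x s -
              2 * ∑ x ∈ S ^ (2 * R + 1), ∑ s ∈ S, b x s +
              ∑ x ∈ S ^ (2 * R + 1), ∑ s ∈ S, c x s := fun a b c => by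
          simp only [Finset.sum_add_distrib, Finset.sum_sub_distrib, Finset.mul_sum]
        refine (hsplit (fun x s => p (x * s) ^ 2 * f (x * s) * (f (x * s) - f x))
          (fun x s => p x ^ 2 * f x * (f (x * s) - f x)) _).trans ?_
        rw [hzero1, hzero2]
        ring
    _ = ∑ s ∈ S, (4 * ∑ x ∈ S ^ (2 * R + 1), f (x * s) ^ 2 +
          1 / 2 * ∑ x ∈ S ^ (2 * R + 1), f x ^ 2) := by
        rw [Finset.sum_comm]
        simp only [Finset.sum_add_distrib, ← Finset.mul_sum]
    _ ≤ ∑ s ∈ S, (4 * ∑ x ∈ S ^ (4 * R), f x ^ 2 + 1 / 2 * ∑ x ∈ S ^ (4 * R), f x ^ 2) := by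
        refine Finset.sum_le_sum fun s hs => ?_
        have h1 := sum_pow_mul_right_le hsq (2 * R + 1) (n := 1) (by simpa using hs : s ∈ S ^ 1)
        have h2 := sum_pow_mono hone hsq (by omega : 2 * R + 1 + 1 ≤ 4 * R)
        have h3 := sum_pow_mono hone hsq (by omega : 2 * R + 1 ≤ 4 * R)
        linarith
    _ = _ := by
        rw [Finset.sum_const, nsmul_eq_mul]
        ring

lemma sum_sq_sub_translate_le (hone : (1 : G) ∈ S) (f : G → ℝ) (m : ℕ) {n : ℕ} {g : G}
    (hg : g ∈ S ^ n) :
    ∑ x ∈ S ^ m, (f (x * g) - f x) ^ 2 ≤ (n : ℝ) ^ 2 * ∑ x ∈ S ^ (m + n), gradSq S f x := by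
  induction n generalizing g with
  | zero =>
    obtain rfl : g = 1 := by simpa using hg
    simp
  | succ n ih =>
    obtain ⟨g, hg', s, hs, rfl⟩ := Finset.mem_mul.mp (pow_succ S n ▸ hg)
    have h0 : ∀ x, 0 ≤ gradSq S f x := gradSq_nonneg S f
    have h1 := ih hg'
    have h2 : ∑ x ∈ S ^ m, (f (x * (g * s)) - f (x * g)) ^ 2 ≤
        ∑ x ∈ S ^ (m + n), gradSq S f x := by
      refine le_trans (Finset.sum_le_sum fun x _ => ?_) (sum_pow_mul_right_le h0 m hg')
      rw [← mul_assoc]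
      exact Finset.single_le_sum (f := fun s => (f (x * g * s) - f (x * g)) ^ 2)
        (fun s _ => sq_nonneg _) hs
    have h3 := sum_pow_mono hone h0 (by omega : m + n ≤ m + (n + 1))
    have h4 : ∑ x ∈ S ^ (m + n), gradSq S f x ≥ 0 := Finset.sum_nonneg fun x _ => h0 x
    rcases Nat.eq_zero_or_pos n with rfl | hn
    · obtain rfl : g = 1 := by simpa using hg'
      simp only [mul_one, one_mul, zero_add, Nat.cast_one, one_pow] at h2 ⊢
      linarith
    · have hn' : (0 : ℝ) < n := by exact_mod_cast hn
      have hpt : ∀ x, n * (f (x * (g * s)) - f x) ^ 2 ≤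
          (n + 1) * (f (x * g) - f x) ^ 2 +
            n * (n + 1) * (f (x * (g * s)) - f (x * g)) ^ 2 := fun x => by
        nlinarith [sq_nonneg ((f (x * g) - f x) - n * (f (x * (g * s)) - f (x * g)))]
      have hsum := Finset.sum_le_sum fun x (_ : x ∈ S ^ m) => hpt x
      simp only [Finset.sum_add_distrib, ← Finset.mul_sum] at hsum
      refine le_of_mul_le_mul_left (hsum.trans ?_) hn'
      push_cast
      calc _ ≤ (n + 1) * ((n : ℝ) ^ 2 * ∑ x ∈ S ^ (m + n), gradSq S f x) +
            n * (n + 1) * ∑ x ∈ S ^ (m + n), gradSq S f x := by gcongr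
        _ = n * (((n : ℝ) + 1) ^ 2 * ∑ x ∈ S ^ (m + n), gradSq S f x) := by ring
        _ ≤ _ := by gcongr

/-- Kleiner's Poincaré inequality for word balls. -/
lemma card_mul_sum_sq_le (hinv : S⁻¹ = S) (hone : (1 : G) ∈ S) (f : G → ℝ) (r : ℕ)
    (hf : ∑ x ∈ S ^ r, f x = 0) :
    2 * ((S ^ r).card : ℝ) * ∑ x ∈ S ^ r, f x ^ 2 ≤
      (S ^ (2 * r)).card * ((2 * r : ℝ) ^ 2 * ∑ x ∈ S ^ (3 * r), gradSq S f x) := by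
  have h0 : ∀ x, 0 ≤ gradSq S f x := gradSq_nonneg S f
  calc 2 * ((S ^ r).card : ℝ) * ∑ x ∈ S ^ r, f x ^ 2
      = ∑ x ∈ S ^ r, ∑ y ∈ S ^ r, (f y - f x) ^ 2 := by
        have : ∀ x y, (f y - f x) ^ 2 = f y ^ 2 + f x ^ 2 - 2 * (f x * f y) := fun x y => by ring
        simp only [this, Finset.sum_add_distrib, Finset.sum_sub_distrib, ← Finset.mul_sum, hf,
          Finset.sum_const, nsmul_eq_mul, mul_zero]
        ring
    _ ≤ ∑ x ∈ S ^ r, ∑ g ∈ S ^ (2 * r), (f (x * g) - f x) ^ 2 := by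
        refine Finset.sum_le_sum fun x hx => ?_
        rw [← Finset.sum_image (f := fun y => (f y - f x) ^ 2) (g := fun g => x * g)
          fun y _ z _ hyz => mul_left_cancel hyz]
        refine Finset.sum_le_sum_of_subset_of_nonneg (fun y hy => ?_) fun _ _ _ => sq_nonneg _
        refine Finset.mem_image.mpr ⟨x⁻¹ * y, ?_, by simp⟩
        rw [two_mul]
        exact mul_mem_pow (inv_mem_pow hinv hx) hy
    _ = ∑ g ∈ S ^ (2 * r), ∑ x ∈ S ^ r, (f (x * g) - f x) ^ 2 := Finset.sum_comm
    _ ≤ ∑ _g ∈ S ^ (2 * r), (2 * r : ℝ) ^ 2 * ∑ x ∈ S ^ (3 * r), gradSq S f x := by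
        refine Finset.sum_le_sum fun g hg => ?_
        have := sum_sq_sub_translate_le hone f r hg
        rw [show r + 2 * r = 3 * r by ring] at this
        exact_mod_cast this
    _ = _ := by rw [Finset.sum_const, nsmul_eq_mul]

lemma exists_separated_net (hinv : S⁻¹ = S) (hone : (1 : G) ∈ S) (R r : ℕ) :
    ∃ X ⊆ S ^ R, (∀ x ∈ X, ∀ y ∈ X, ∀ z ∈ S ^ r, ∀ w ∈ S ^ r, x * z = y * w → x = y) ∧
      ∀ y ∈ S ^ R, ∃ x ∈ X, x⁻¹ * y ∈ S ^ (2 * r) := by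
  classical
  set P : Finset (Finset G) := (S ^ R).powerset.filter fun X =>
    ∀ x ∈ X, ∀ y ∈ X, ∀ z ∈ S ^ r, ∀ w ∈ S ^ r, x * z = y * w → x = y with hP
  obtain ⟨X, hX, hmax⟩ := P.exists_max_image Finset.card ⟨∅, by simp [hP]⟩
  obtain ⟨hXsub, hXsep⟩ := Finset.mem_filter.mp hX
  rw [Finset.mem_powerset] at hXsub
  refine ⟨X, hXsub, hXsep, fun y hy => ?_⟩
  by_contra! hfar
  have hfar' : ∀ x ∈ X, ∀ z ∈ S ^ r, ∀ w ∈ S ^ r, x * z ≠ y * w := fun x hx z hz w hw h => by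
    apply hfar x hx
    have : x⁻¹ * y = z * w⁻¹ := by
      rw [eq_mul_inv_iff_mul_eq, mul_assoc, ← h, inv_mul_cancel_left]
    rw [this, two_mul]
    exact mul_mem_pow hz (inv_mem_pow hinv hw)
  have hyX : y ∉ X := fun h => hfar y h (by simpa using Finset.one_mem_pow hone)
  have := hmax (insert y X) (Finset.mem_filter.mpr ⟨?_, ?_⟩)
  · rw [Finset.card_insert_of_notMem hyX] at this
    omega
  · exact Finset.mem_powerset.mpr (Finset.insert_subset hy hXsub)
  · intro a ha b hb z hz w hw h
    rcases Finset.mem_insert.mp ha with rfl | haX <;>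
      rcases Finset.mem_insert.mp hb with rfl | hbX
    · rfl
    · exact absurd h.symm (hfar' b hbX w hw z hz)
    · exact absurd h (hfar' a haX z hz w hw)
    · exact hXsep a haX b hbX z hz w hw h

lemma card_filter_mul_card_le {X : Finset G} {r : ℕ}
    (hX : ∀ x ∈ X, ∀ y ∈ X, ∀ z ∈ S ^ r, ∀ w ∈ S ^ r, x * z = y * w → x = y) (m : ℕ) (y : G) :
    (X.filter fun x => y⁻¹ * x ∈ S ^ m).card * (S ^ r).card ≤ (S ^ (m + r)).card := by
  rw [← Finset.card_product]
  refine Finset.card_le_card_of_injOn (fun q => y⁻¹ * q.1 * q.2) ?_ ?_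
  · intro q hq
    simp only [Finset.coe_product, Set.mem_prod, Finset.mem_coe, Finset.mem_filter] at hq
    exact mul_mem_pow hq.1.2 hq.2
  · rintro ⟨a, z⟩ hq ⟨b, w⟩ hq' h
    simp only [Finset.coe_product, Set.mem_prod, Finset.mem_coe, Finset.mem_filter] at hq hq'
    simp only [mul_assoc] at h
    have h' := mul_left_cancel h
    obtain rfl := hX a hq.1.1 b hq'.1.1 z hq.2 w hq'.2 h'
    rw [mul_left_cancel h']

lemma sum_sum_translate_eq {X : Finset G} {R : ℕ} (hX : X ⊆ S ^ R) (m : ℕ) (h : G → ℝ) :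
    ∑ x ∈ X, ∑ z ∈ S ^ m, h (x * z) =
      ∑ y ∈ S ^ (R + m), (X.filter fun x => x⁻¹ * y ∈ S ^ m).card * h y := by
  have hin : ∀ x ∈ X, ∑ z ∈ S ^ m, h (x * z) =
      ∑ y ∈ S ^ (R + m), if x⁻¹ * y ∈ S ^ m then h y else 0 := fun x hx => by
    rw [← Finset.sum_filter]
    refine Finset.sum_nbij' (fun z => x * z) (fun y => x⁻¹ * y) ?_ ?_ ?_ ?_ ?_
    · intro z hz
      exact Finset.mem_filter.mpr ⟨mul_mem_pow (hX hx) hz, by simpa using hz⟩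
    · intro y hy
      exact (Finset.mem_filter.mp hy).2
    all_goals simp
  rw [Finset.sum_congr rfl hin, Finset.sum_comm]
  refine Finset.sum_congr rfl fun y _ => ?_
  rw [← Finset.sum_filter, Finset.sum_const, nsmul_eq_mul]

/-- If the word balls are doubling at scale `r`, a harmonic function with vanishing averages on
suitable balls of radius `2 * r` grows fast from scale `R` to scale `8 * R`. -/
lemma exists_net_sum_sq_le (hinv : S⁻¹ = S) (hone : (1 : G) ∈ S)
    (hgen : ∀ x : G, ∃ n : ℕ, x ∈ (S : Set G) ^ n) {R r : ℕ} (hr : 1 ≤ r) (hrR : 8 * r ≤ R)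
    {A : ℝ} (hA : ((S ^ (8 * r)).card : ℝ) ≤ A * (S ^ r).card) :
    ∃ X : Finset G, X.card * (S ^ r).card ≤ (S ^ (8 * R)).card ∧
      ∀ f : G → ℝ, (∀ x, ∑ s ∈ S, (f (x * s) - f x) = 0) →
        (∀ x ∈ X, ∑ z ∈ S ^ (2 * r), f (x * z) = 0) →
        (R : ℝ) ^ 2 * ∑ x ∈ S ^ R, f x ^ 2 ≤
          9 * S.card * A ^ 2 * (r : ℝ) ^ 2 * ∑ x ∈ S ^ (8 * R), f x ^ 2 := by
  have hcard_mono : ∀ {m n : ℕ}, m ≤ n → (S ^ m).card ≤ (S ^ n).card := fun h =>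
    Finset.card_le_card (Finset.pow_subset_pow_right hone h)
  have hpos : ∀ n, (0 : ℝ) < (S ^ n).card := fun n =>
    Nat.cast_pos.mpr (Finset.card_pos.mpr ⟨1, Finset.one_mem_pow hone⟩)
  have hA0 : 0 ≤ A := by
    by_contra! h
    nlinarith [hpos r, hpos (8 * r)]
  obtain ⟨X, hXsub, hXsep, hXcov⟩ := exists_separated_net hinv hone R r
  refine ⟨X, ?_, fun f hf hmean => ?_⟩
  · have h := card_filter_mul_card_le hXsep R 1
    rw [Finset.filter_true_of_mem fun x hx => by simpa using hXsub hx] at h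
    exact h.trans (hcard_mono (by omega))
  have hg0 : ∀ x, 0 ≤ gradSq S f x := gradSq_nonneg S f
  have hoverlap : ∀ y, ((X.filter fun x => x⁻¹ * y ∈ S ^ (6 * r)).card : ℝ) ≤ A := fun y => by
    have h := card_filter_mul_card_le hXsep (6 * r) y
    have heq : (X.filter fun x => y⁻¹ * x ∈ S ^ (6 * r)) =
        X.filter fun x => x⁻¹ * y ∈ S ^ (6 * r) := by
      refine Finset.filter_congr fun x _ => ?_
      rw [← inv_mem_pow_iff hinv, mul_inv_rev, inv_inv]
    rw [heq] at h
    have h' := (Nat.cast_le (α := ℝ)).mpr (h.trans (hcard_mono (by omega : 6 * r + r ≤ 8 * r)))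
    rw [Nat.cast_mul] at h'
    exact le_of_mul_le_mul_right (h'.trans hA) (hpos r)
  have hpoinc : ∀ x ∈ X, ∑ z ∈ S ^ (2 * r), f (x * z) ^ 2 ≤
      8 * A * (r : ℝ) ^ 2 * ∑ z ∈ S ^ (6 * r), gradSq S f (x * z) := fun x hx => by
    have h := card_mul_sum_sq_le hinv hone (fun z => f (x * z)) (2 * r) (hmean x hx)
    have hgrad : ∀ z, gradSq S (fun z => f (x * z)) z = gradSq S f (x * z) := fun z => by
      simp only [gradSq, mul_assoc]
    simp only [hgrad, show 3 * (2 * r) = 6 * r by ring, show 2 * (2 * r) = 4 * r by ring] at h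
    have h1 : ((S ^ (4 * r)).card : ℝ) ≤ A * (S ^ (2 * r)).card := by
      have h2 : ((S ^ (4 * r)).card : ℝ) ≤ (S ^ (8 * r)).card := by
        exact_mod_cast hcard_mono (by omega)
      have h3 : ((S ^ r).card : ℝ) ≤ (S ^ (2 * r)).card := by
        exact_mod_cast hcard_mono (by omega)
      nlinarith
    have hs : 0 ≤ ∑ z ∈ S ^ (6 * r), gradSq S f (x * z) := Finset.sum_nonneg fun z _ => hg0 _
    refine le_of_mul_le_mul_left ?_ (by have := hpos (2 * r); positivity :
      (0 : ℝ) < 2 * (S ^ (2 * r)).card)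
    refine h.trans ?_
    push_cast
    calc _ ≤ A * (S ^ (2 * r)).card *
          ((2 * (2 * r) : ℝ) ^ 2 * ∑ z ∈ S ^ (6 * r), gradSq S f (x * z)) := by gcongr
      _ = _ := by ring
  have hcacc := sum_gradSq_le hinv hone hgen hf (by omega : 1 ≤ 2 * R)
  rw [show 4 * (2 * R) = 8 * R by ring] at hcacc
  push_cast at hcacc
  have hlocal : ∑ y ∈ S ^ R, f y ^ 2 ≤ 8 * A ^ 2 * (r : ℝ) ^ 2 *
      ∑ y ∈ S ^ (2 * R), gradSq S f y := by
    calc ∑ y ∈ S ^ R, f y ^ 2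
        ≤ ∑ y ∈ S ^ R, (X.filter fun x => x⁻¹ * y ∈ S ^ (2 * r)).card * f y ^ 2 := by
          refine Finset.sum_le_sum fun y hy => le_mul_of_one_le_left (sq_nonneg _) ?_
          obtain ⟨x, hx, hxy⟩ := hXcov y hy
          exact_mod_cast Finset.card_pos.mpr ⟨x, Finset.mem_filter.mpr ⟨hx, hxy⟩⟩
      _ ≤ ∑ y ∈ S ^ (R + 2 * r), (X.filter fun x => x⁻¹ * y ∈ S ^ (2 * r)).card * f y ^ 2 :=
          sum_pow_mono hone (fun y => by positivity) (by omega)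
      _ = ∑ x ∈ X, ∑ z ∈ S ^ (2 * r), f (x * z) ^ 2 :=
          (sum_sum_translate_eq hXsub (2 * r) fun y => f y ^ 2).symm
      _ ≤ ∑ x ∈ X, 8 * A * (r : ℝ) ^ 2 * ∑ z ∈ S ^ (6 * r), gradSq S f (x * z) :=
          Finset.sum_le_sum hpoinc
      _ = 8 * A * (r : ℝ) ^ 2 * ∑ y ∈ S ^ (R + 6 * r),
            (X.filter fun x => x⁻¹ * y ∈ S ^ (6 * r)).card * gradSq S f y := by
          rw [← Finset.mul_sum, sum_sum_translate_eq hXsub]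
      _ ≤ 8 * A * (r : ℝ) ^ 2 * ∑ y ∈ S ^ (R + 6 * r), A * gradSq S f y := by
          refine mul_le_mul_of_nonneg_left (Finset.sum_le_sum fun y _ => ?_) (by positivity)
          exact mul_le_mul_of_nonneg_right (hoverlap y) (hg0 y)
      _ ≤ 8 * A * (r : ℝ) ^ 2 * ∑ y ∈ S ^ (2 * R), A * gradSq S f y := by
          refine mul_le_mul_of_nonneg_left ?_ (by positivity)
          exact sum_pow_mono hone (fun y => mul_nonneg hA0 (hg0 y)) (by omega)
      _ = _ := by rw [← Finset.mul_sum]; ring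
  calc (R : ℝ) ^ 2 * ∑ x ∈ S ^ R, f x ^ 2
      ≤ (R : ℝ) ^ 2 * (8 * A ^ 2 * (r : ℝ) ^ 2 * ∑ y ∈ S ^ (2 * R), gradSq S f y) := by gcongr
    _ = 2 * A ^ 2 * (r : ℝ) ^ 2 * ((2 * R) ^ 2 * ∑ y ∈ S ^ (2 * R), gradSq S f y) := by ring
    _ ≤ 2 * A ^ 2 * (r : ℝ) ^ 2 * (9 / 2 * S.card * ∑ x ∈ S ^ (8 * R), f x ^ 2) := by gcongr
    _ = _ := by ring

end WordBalls

section FiniteDimension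

open Matrix

variable {G : Type*} [Group G] [DecidableEq G] {S : Finset G}

lemma det_gramOn_pow_le (hone : (1 : G) ∈ S) (hgen : ∀ x : G, ∃ n : ℕ, x ∈ (S : Set G) ^ n)
    {c : ℝ} {d k : ℕ} (hgrowth : ∀ n : ℕ, 1 ≤ n → ((S ^ n).card : ℝ) ≤ c * (n : ℝ) ^ d)
    {ι : Type*} [Fintype ι] [DecidableEq ι] {b : ι → G → ℝ} {c₀ : ℝ}
    (hb : ∀ i x, |b i x| ≤ c₀ * (1 + (wordNorm (S : Set G) x : ℝ)) ^ k) {n : ℕ} (hn : 1 ≤ n) :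
    (gramOn (S ^ n) b).det ≤
      (Fintype.card ι * (c₀ ^ 2 * 4 ^ k * c) * (n : ℝ) ^ (d + 2 * k)) ^ Fintype.card ι := by
  have hpsd := gramOn_posSemidef (S ^ n) b
  refine (det_le_trace_pow hpsd).trans (pow_le_pow_left₀ hpsd.trace_nonneg ?_ _)
  have hn' : (1 : ℝ) ≤ n := by exact_mod_cast hn
  have hval : ∀ i, ∀ x ∈ S ^ n, b i x * b i x ≤ c₀ ^ 2 * 4 ^ k * (n : ℝ) ^ (2 * k) := by
    intro i x hx
    have hx' : (wordNorm (S : Set G) x : ℝ) ≤ n := by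
      exact_mod_cast (mem_pow_iff_wordNorm_le hone hgen).mp hx
    calc b i x * b i x = |b i x| ^ 2 := by rw [sq_abs, sq]
      _ ≤ (c₀ * (1 + (wordNorm (S : Set G) x : ℝ)) ^ k) ^ 2 := by gcongr; exact hb i x
      _ = c₀ ^ 2 * ((1 + (wordNorm (S : Set G) x : ℝ)) ^ k) ^ 2 := by ring
      _ ≤ c₀ ^ 2 * ((2 * n : ℝ) ^ k) ^ 2 := by gcongr; linarith
      _ = _ := by
        have h4 : (4 : ℝ) ^ k = (2 ^ k) ^ 2 := by rw [← pow_mul, mul_comm, pow_mul]; norm_num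
        rw [h4, mul_pow]
        ring
  calc (gramOn (S ^ n) b).trace = ∑ i, ∑ x ∈ S ^ n, b i x * b i x := by
        simp [gramOn, Matrix.trace]
    _ ≤ ∑ _i : ι, ∑ _x ∈ S ^ n, c₀ ^ 2 * 4 ^ k * (n : ℝ) ^ (2 * k) :=
        Finset.sum_le_sum fun i _ => Finset.sum_le_sum fun x hx => hval i x hx
    _ = Fintype.card ι * ((S ^ n).card * (c₀ ^ 2 * 4 ^ k * (n : ℝ) ^ (2 * k))) := by simp
    _ ≤ Fintype.card ι * (c * (n : ℝ) ^ d * (c₀ ^ 2 * 4 ^ k * (n : ℝ) ^ (2 * k))) := by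
        gcongr
        exact hgrowth n hn
    _ = _ := by ring

/-- The bound on the dimension of the space of harmonic functions of polynomial growth. -/
lemma exists_card_le_of_linearIndependent (hinv : S⁻¹ = S) (hone : (1 : G) ∈ S)
    (hgen : ∀ x : G, ∃ n : ℕ, x ∈ (S : Set G) ^ n) {c : ℝ} {d : ℕ}
    (hgrowth : ∀ n : ℕ, 1 ≤ n → ((S ^ n).card : ℝ) ≤ c * (n : ℝ) ^ d) (k : ℕ) :
    ∃ N : ℕ, ∀ {ι : Type _} [Fintype ι] (b : ι → G → ℝ), LinearIndependent ℝ b →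
      (∀ i x, ∑ s ∈ S, (b i (x * s) - b i x) = 0) →
      (∃ c₀, ∀ i x, |b i x| ≤ c₀ * (1 + (wordNorm (S : Set G) x : ℝ)) ^ k) →
      Fintype.card ι ≤ N := by
  classical
  set K : ℝ := 8 ^ (2 * d + 2 * k) with hK
  set A : ℝ := (2 * K) ^ 3 with hA
  have hK1 : 1 ≤ K := one_le_pow₀ (by norm_num)
  have hA1 : 1 ≤ A := one_le_pow₀ (by linarith)
  have hcardpos : ∀ n, (0 : ℝ) < (S ^ n).card := fun n =>
    Nat.cast_pos.mpr (Finset.card_pos.mpr ⟨1, Finset.one_mem_pow hone⟩)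
  obtain ⟨w, hw, hAw⟩ : ∃ w : ℕ, 1 ≤ w ∧ 9 * S.card * A ^ 4 < (64 : ℝ) ^ w := by
    obtain ⟨w, hw⟩ := pow_unbounded_of_one_lt (9 * S.card * A ^ 4) (by norm_num : (1 : ℝ) < 64)
    exact ⟨w + 1, by omega, hw.trans_le (pow_le_pow_right₀ (by norm_num) (by omega))⟩
  set δ : ℝ := 9 * S.card * A ^ 2 / 64 ^ w with hδ
  have hδ0 : 0 ≤ δ := by positivity
  have hδA : δ * A ^ 2 < 1 := by
    rw [hδ, div_mul_eq_mul_div, div_lt_one (by positivity)]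
    calc _ = 9 * S.card * A ^ 4 := by ring
      _ < _ := hAw
  have hδ1 : δ ≤ 1 := (le_mul_of_one_le_right hδ0 (one_le_pow₀ hA1)).trans hδA.le
  refine ⟨⌊2 * A ^ w⌋₊, fun {ι} _ b hb hharm ⟨c₀, hc₀⟩ => ?_⟩
  by_contra! hlt
  set D := Fintype.card ι with hD
  have hDA : 2 * A ^ w < D := Nat.lt_of_floor_lt hlt
  have hD0 : D ≠ 0 := by omega
  set B : ℕ → Finset G := fun i => S ^ 8 ^ i with hB
  have hBmono : Monotone B := fun i j hij =>
    Finset.pow_subset_pow_right hone (Nat.pow_le_pow_right (by norm_num) hij)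
  have hBcard : ∀ {i j}, i ≤ j → ((B i).card : ℝ) ≤ (B j).card := fun hij => by
    exact_mod_cast Finset.card_le_card (hBmono hij)
  obtain ⟨i₀, hi₀⟩ := exists_forall_gramOn_posDef hb hBmono fun x =>
    ⟨wordNorm (S : Set G) x, (mem_pow_iff_wordNorm_le hone hgen).mpr
      (Nat.lt_pow_self (by norm_num)).le⟩
  set M : ℕ → ℝ := fun i => (gramOn (B i) b).det with hM
  have hMpos : ∀ i ≥ i₀, 0 < M i := fun i hi => (hi₀ i hi).det_pos
  have hMmono : ∀ {i j}, i₀ ≤ i → i ≤ j → M i ≤ M j := fun hi hij =>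
    det_gramOn_mono (hBmono hij) (hi₀ _ (hi.trans hij))
  set u : ℕ → ℝ := fun i => ((B i).card : ℝ) ^ D * M i with hu
  have hupos : ∀ i ≥ i₀, 0 < u i := fun i hi => mul_pos (pow_pos (hcardpos _) _) (hMpos i hi)
  have humono : ∀ i ≥ i₀, u i ≤ u (i + 1) := fun i hi =>
    mul_le_mul (pow_le_pow_left₀ (hcardpos _).le (hBcard i.le_succ) _) (hMmono hi i.le_succ)
      (hMpos i hi).le (pow_nonneg (hcardpos _).le _)
  have hule : ∀ i, u i ≤ (c * (D * (c₀ ^ 2 * 4 ^ k * c))) ^ D * (K ^ D) ^ i := fun i => by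
    have h1 : 1 ≤ 8 ^ i := Nat.one_le_pow _ _ (by norm_num)
    have h2 := det_gramOn_pow_le hone hgen hgrowth hc₀ h1
    have h3 := pow_le_pow_left₀ (hcardpos _).le (hgrowth _ h1) D
    calc u i ≤ (c * ((8 ^ i : ℕ) : ℝ) ^ d) ^ D *
          (D * (c₀ ^ 2 * 4 ^ k * c) * ((8 ^ i : ℕ) : ℝ) ^ (d + 2 * k)) ^ D :=
          mul_le_mul h3 h2 (gramOn_posSemidef _ b).det_nonneg
            ((pow_nonneg (hcardpos _).le _).trans h3)
      _ = (c * (D * (c₀ ^ 2 * 4 ^ k * c))) ^ D * (((8 : ℝ) ^ i) ^ (2 * d + 2 * k)) ^ D := by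
          rw [← mul_pow, ← mul_pow]
          push_cast
          ring
      _ = _ := by rw [hK]; ring
  have hsplit : ∀ {i j : ℕ} {E : ℝ}, 0 ≤ E → i₀ ≤ i → i ≤ j → u j ≤ E ^ D * u i →
      ((B j).card : ℝ) ≤ E * (B i).card ∧ M j ≤ E ^ D * M i := by
    intro i j E hE hi hij h
    have hMi := hMpos i hi
    have hMij := hMmono hi hij
    have hcij : ((B i).card : ℝ) ^ D ≤ ((B j).card : ℝ) ^ D :=
      pow_le_pow_left₀ (hcardpos _).le (hBcard hij) _
    have hci : (0 : ℝ) < ((B i).card : ℝ) ^ D := pow_pos (hcardpos _) _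
    constructor
    · refine (pow_le_pow_iff_left₀ (hcardpos _).le (mul_nonneg hE (hcardpos _).le) hD0).mp ?_
      rw [mul_pow]
      refine le_of_mul_le_mul_right ?_ hMi
      calc ((B j).card : ℝ) ^ D * M i ≤ ((B j).card : ℝ) ^ D * M j := by gcongr
        _ ≤ E ^ D * u i := h
        _ = _ := by simp only [hu]; ring
    · refine le_of_mul_le_mul_left ?_ hci
      calc ((B i).card : ℝ) ^ D * M j ≤ ((B j).card : ℝ) ^ D * M j := by
            have := hMi.le.trans hMij
            gcongr
        _ ≤ E ^ D * u i := h
        _ = _ := by simp only [hu]; ring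
  have hQ : 2 * K ^ D ≤ (2 * K) ^ D := by
    rw [mul_pow]
    gcongr
    exact le_self_pow₀ one_le_two hD0
  obtain ⟨a, i, j, ha, hai, hij, hja, hui, huj, hua⟩ :=
    exists_slow_scales (by positivity) hQ hupos humono hule hw
  have hQA : ((2 * K) ^ D) ^ 3 = A ^ D := pow_right_comm _ _ _
  rw [hQA] at hui huj hua
  rw [← pow_mul, mul_comm D w, pow_mul] at hua
  have hA0 : 0 ≤ A := by linarith
  have hball := (hsplit hA0 (by omega) i.le_succ hui).1
  have hdet := (hsplit hA0 (by omega) j.le_succ huj).2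
  have hcov := (hsplit (pow_nonneg hA0 w) ha (by omega) hua).1
  have h8 : ∀ m, 8 * 8 ^ m = 8 ^ (m + 1) := fun m => by ring
  obtain ⟨X, hX, hXf⟩ := exists_net_sum_sq_le hinv hone hgen (R := 8 ^ j) (r := 8 ^ i) (A := A)
    (Nat.one_le_pow _ _ (by norm_num))
    (by rw [h8]; exact Nat.pow_le_pow_right (by norm_num) (by omega)) (by rw [h8]; exact hball)
  rw [h8] at hX hXf
  have hXcard : (X.card : ℝ) ≤ A ^ w := by
    refine le_of_mul_le_mul_right ?_ (hcardpos (8 ^ i))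
    calc (X.card : ℝ) * (B i).card ≤ (B (j + 1)).card := by exact_mod_cast hX
      _ ≤ (B (a + 3 * w)).card := hBcard hja
      _ ≤ A ^ w * (B a).card := hcov
      _ ≤ A ^ w * (B i).card := mul_le_mul_of_nonneg_left (hBcard hai) (pow_nonneg hA0 w)
  let L : (ι → ℝ) →ₗ[ℝ] (X → ℝ) :=
    LinearMap.pi fun x => ∑ z ∈ S ^ (2 * 8 ^ i),
      (LinearMap.proj (x.1 * z)).comp (Fintype.linearCombination ℝ b)
  have hcontract : ∀ v, L v = 0 →
      v ⬝ᵥ gramOn (B j) b *ᵥ v ≤ δ * (v ⬝ᵥ gramOn (B (j + 1)) b *ᵥ v) := by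
    intro v hv
    rw [dotProduct_gramOn_mulVec, dotProduct_gramOn_mulVec]
    have h := hXf (fun x => ∑ i, v i * b i x) (fun x => ?_) (fun x hx => ?_)
    · have hR : (8 : ℝ) ^ j ≥ 8 ^ w * 8 ^ i := by
        rw [← pow_add]
        exact pow_le_pow_right₀ (by norm_num) (by omega)
      have hR2 : ((8 : ℝ) ^ j) ^ 2 ≥ 64 ^ w * (8 ^ i) ^ 2 := by
        calc ((8 : ℝ) ^ j) ^ 2 ≥ (8 ^ w * 8 ^ i) ^ 2 := by gcongr
          _ = _ := by
            have h64 : (64 : ℝ) ^ w = (8 ^ w) ^ 2 := by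
              rw [← pow_mul, mul_comm, pow_mul]
              norm_num
            rw [h64, mul_pow]
      push_cast at h
      have hs : 0 ≤ ∑ x ∈ B j, (∑ i, v i * b i x) ^ 2 :=
        Finset.sum_nonneg fun _ _ => sq_nonneg _
      refine le_of_mul_le_mul_left ?_ (by positivity : (0 : ℝ) < 64 ^ w * (8 ^ i) ^ 2)
      refine (mul_le_mul_of_nonneg_right hR2 hs).trans (h.trans_eq ?_)
      rw [hδ]
      field_simp
      rfl
    · simp only [← Finset.sum_sub_distrib, ← mul_sub]
      rw [Finset.sum_comm]
      exact Finset.sum_eq_zero fun i _ => by rw [← Finset.mul_sum, hharm, mul_zero]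
    · simpa [L, Fintype.linearCombination_apply] using congrFun hv ⟨x, hx⟩
  have hmain := det_le_pow_mul_det (gramOn_posSemidef (B j) b) (hi₀ (j + 1) (by omega))
    (fun v => by
      simp only [dotProduct_gramOn_mulVec]
      exact Finset.sum_le_sum_of_subset_of_nonneg (hBmono j.le_succ) fun _ _ _ => sq_nonneg _)
    L hδ0 hδ1 hcontract
  rw [Fintype.card_coe] at hmain
  have h2X : 2 * X.card < D := by
    have : (2 * X.card : ℝ) < D := by linarith
    exact_mod_cast this
  have hMj := hMpos j (by omega)
  set e := D - X.card with he
  have hfactor : δ ^ e * A ^ D < 1 := by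
    calc δ ^ e * A ^ D ≤ δ ^ e * A ^ (2 * e) := by
          gcongr
          omega
      _ = (δ * A ^ 2) ^ e := by rw [mul_pow, pow_mul A 2 e]
      _ < 1 := pow_lt_one₀ (by positivity) hδA (by omega)
  have : M j ≤ δ ^ e * A ^ D * M j := by
    calc M j ≤ δ ^ e * M (j + 1) := hmain
      _ ≤ δ ^ e * (A ^ D * M j) := by gcongr
      _ = _ := by ring
  nlinarith

end FiniteDimension

/-- **Kleiner's theorem.**  On a finitely generated group of polynomial growth, with finite
symmetric generating set `S` containing the identity, the space of functions harmonic with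
respect to the uniform measure on `S` and of polynomial growth of degree at most `k` is
finite dimensional. -/
theorem stmt1 {G : Type*} [Group G] (S : Finset G)
    (hSsymm : (S : Set G)⁻¹ = (S : Set G)) (hSone : (1 : G) ∈ S)
    (hSgen : ∀ x : G, ∃ n : ℕ, x ∈ (S : Set G) ^ n)
    (hgrowth : ∃ c > 0, ∃ d > 0, ∀ n : ℕ, 1 ≤ n →
      (Nat.card (((S : Set G) ^ n : Set G) : Type _) : ℝ) ≤ c * (n : ℝ) ^ d)
    (k : ℕ) :
    FiniteDimensional ℝ (Submodule.span ℝ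
      {f : G → ℝ |
        (∀ x : G, f x = (S.card : ℝ)⁻¹ * ∑ s ∈ S, f (x * s)) ∧
        ∃ c > 0, ∀ x : G, |f x| ≤ c * (1 + (wordNorm (S : Set G) x : ℝ)) ^ k}) := by
  classical
  have hinv : S⁻¹ = S := Finset.coe_injective (by rw [Finset.coe_inv, hSsymm])
  obtain ⟨c, -, d, -, hgrowth⟩ := hgrowth
  have hgrowth' : ∀ n : ℕ, 1 ≤ n → ((S ^ n).card : ℝ) ≤ c * (n : ℝ) ^ d := fun n hn => by
    have h := hgrowth n hn
    rwa [← Finset.coe_pow, Nat.card_coe_set_eq, Set.ncard_coe_finset] at h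
  obtain ⟨N, hN⟩ := exists_card_le_of_linearIndependent hinv hSone hSgen hgrowth' k
  let H : Submodule ℝ (G → ℝ) :=
    { carrier := {f | (∀ x, ∑ s ∈ S, (f (x * s) - f x) = 0) ∧
        ∃ c, 0 ≤ c ∧ ∀ x, |f x| ≤ c * (1 + (wordNorm (S : Set G) x : ℝ)) ^ k}
      zero_mem' := ⟨by simp, 0, le_rfl, by simp⟩
      add_mem' := by
        rintro f g ⟨hf, cf, hcf0, hcf⟩ ⟨hg, cg, hcg0, hcg⟩
        refine ⟨fun x => ?_, cf + cg, add_nonneg hcf0 hcg0, fun x => ?_⟩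
        · simp only [Pi.add_apply, add_sub_add_comm, Finset.sum_add_distrib, hf, hg, add_zero]
        · rw [add_mul]
          exact (abs_add_le _ _).trans (add_le_add (hcf x) (hcg x))
      smul_mem' := by
        rintro t f ⟨hf, cf, hcf0, hcf⟩
        refine ⟨fun x => ?_, |t| * cf, by positivity, fun x => ?_⟩
        · simp only [Pi.smul_apply, smul_eq_mul, ← mul_sub, ← Finset.mul_sum, hf, mul_zero]
        · rw [Pi.smul_apply, smul_eq_mul, abs_mul, mul_assoc]
          exact mul_le_mul_of_nonneg_left (hcf x) (abs_nonneg t) }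
  have hHfin : FiniteDimensional ℝ H := by
    refine Module.rank_lt_aleph0_iff.mp ((rank_le (n := N) fun s hs => ?_).trans_lt
      Cardinal.natCast_lt_aleph0)
    have hlin : LinearIndependent ℝ fun f : s => (f.1 : G → ℝ) :=
      hs.map' H.subtype H.ker_subtype
    choose c hc0 hc using fun f : H => f.2.2
    have h := hN (fun f : s => (f.1 : G → ℝ)) hlin (fun f => f.1.2.1)
      ⟨∑ f : s, c f.1, fun f x => (hc f.1 x).trans ?_⟩
    · simpa using h
    · gcongr
      exact Finset.single_le_sum (f := fun f : s => c f.1) (fun f _ => hc0 f.1)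
        (Finset.mem_univ f)
  refine Submodule.finiteDimensional_of_le (S₂ := H) (Submodule.span_le.mpr ?_)
  rintro f ⟨hf, c, hc0, hc⟩
  refine ⟨fun x => ?_, c, hc0.le, hc⟩
  have hS : (S.card : ℝ) ≠ 0 := Nat.cast_ne_zero.mpr (Finset.card_ne_zero_of_mem hSone)
  rw [Finset.sum_sub_distrib, Finset.sum_const, nsmul_eq_mul]
  rw [hf x, mul_inv_cancel_left₀ hS, sub_self]
end
end

section
/- Let G = ℝ ⋉_φ (ℝ² × ℝ²) be the semidirect product in which a ∈ ℝ acts on ℝ² × ℝ² by φ_a(u,v) = (rotation of u by angle a, rotation of v by angle √2·a). Let μ be the probability measure on G given as follows: with probability 1/2 pick (a,(0,0)) with a uniform on [−1,1], and with probability 1/2 pick (0,(u,v)) with u and v independent, each uniform on the closed unit disc of ℝ². Then the function f : G → ℂ defined by f(a,(u,v)) = u (identifying ℝ² with ℂ) is μ-harmonic, i.e. f(x) = ∫_G f(x·s) dμ(s) for all x ∈ G, but f is not a polynomial on G of any degree: for every n ≥ 0 there exist u₁,…,u_{n+1} ∈ G with ∂_{u₁}⋯∂_{u_{n+1}} f ≠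 0. -/
open MeasureTheory

noncomputable section

/-- The underlying space of the group `G = ℝ ⋉ (ℝ² × ℝ²)`, with `ℝ² ≅ ℂ`. -/
abbrev Gex : Type := ℝ × ℂ × ℂ

/-- The group law of `G = ℝ ⋉ (ℝ² × ℝ²)`: `a ∈ ℝ` acts on the first copy of `ℝ² ≅ ℂ` by
rotation by angle `a` and on the second copy by rotation by angle `√2·a`, so that
`(a,(u,v))·(b,(p,q)) = (a+b, (u + e^{ia} p, v + e^{i√2 a} q))`. -/
def gmul (g h : Gex) : Gex :=
  (g.1 + h.1,
    g.2.1 + Complex.exp ((g.1 : ℂ) * Complex.I) * h.2.1,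
    g.2.2 + Complex.exp (((Real.sqrt 2 * g.1 : ℝ) : ℂ) * Complex.I) * h.2.2)

/-- The uniform probability measure on the closed unit disc of `ℝ² ≅ ℂ`. -/
def discUnif : Measure ℂ :=
  (ENNReal.ofReal Real.pi)⁻¹ • (volume.restrict (Metric.closedBall (0 : ℂ) 1))

/-- The measure `μ`: with probability `1/2` an element `(a,(0,0))` with `a ~ U[-1,1]`, and
with probability `1/2` an element `(0,(u,v))` with `u, v` i.i.d. uniform on the unit disc. -/
def μex : Measure Gex :=
  (2⁻¹ : ENNReal) • Measure.map (fun a : ℝ => ((a, 0, 0) : Gex))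
      ((2⁻¹ : ENNReal) • volume.restrict (Set.Icc (-1 : ℝ) 1)) +
  (2⁻¹ : ENNReal) • Measure.map (fun p : ℂ × ℂ => (((0 : ℝ), p.1, p.2) : Gex))
      (discUnif.prod discUnif)

/-- The function `f(a,(u,v)) = u` (with `ℝ²` identified with `ℂ`). -/
def fex : Gex → ℂ := fun g => g.2.1

/-- The left derivative `∂_u f (x) = f(ux) − f(x)` with respect to the group law `gmul`. -/
def lderivG (u : Gex) (f : Gex → ℂ) : Gex → ℂ := fun x => f (gmul u x) - f x

instance isProbabilityMeasure_discUnif : IsProbabilityMeasure discUnif := by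
  constructor
  have h : ENNReal.ofReal Real.pi = (NNReal.pi : ENNReal) := by
    rw [← ENNReal.ofReal_coe_nnreal, NNReal.coe_real_pi]
  simp only [discUnif, Measure.smul_apply, Measure.restrict_apply_univ, Complex.volume_closedBall,
    smul_eq_mul, ENNReal.ofReal_one, one_pow, one_mul, h]
  exact ENNReal.inv_mul_cancel (by simp [NNReal.pi_ne_zero]) ENNReal.coe_ne_top

lemma integrable_id_discUnif : Integrable (fun u : ℂ => u) discUnif := by
  refine Integrable.smul_measure ?_ (by simp [Real.pi_pos])
  exact continuous_id.continuousOn.integrableOn_compact (isCompact_closedBall 0 1)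

lemma integral_id_discUnif : ∫ u, u ∂discUnif = 0 := by
  have h : ∫ u in Metric.closedBall (0 : ℂ) 1, u = 0 := by
    rw [← integral_indicator Metric.isClosed_closedBall.measurableSet]
    refine self_eq_neg.mp ?_
    rw [← integral_neg]
    nth_rewrite 1 [← integral_neg_eq_self]
    refine integral_congr_ae (.of_forall fun u => ?_)
    by_cases hu : ‖u‖ ≤ 1 <;> simp [Set.indicator, hu]
  rw [discUnif, integral_smul_measure, h, smul_zero]

lemma integral_affine_μex (c d : ℂ) : ∫ s : Gex, (c + d * s.2.1) ∂μex = c := by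
  have hF : Continuous fun s : Gex => c + d * s.2.1 := by fun_prop
  have hm₁ : Measurable fun a : ℝ => ((a, 0, 0) : Gex) := by fun_prop
  have hm₂ : Measurable fun p : ℂ × ℂ => ((0, p.1, p.2) : Gex) := by fun_prop
  have hd : Integrable (fun u : ℂ => c + d * u) discUnif :=
    (integrable_const c).add (integrable_id_discUnif.const_mul d)
  have hi₁ : Integrable (fun s : Gex => c + d * s.2.1)
      (Measure.map (fun a : ℝ => ((a, 0, 0) : Gex))
        ((2⁻¹ : ENNReal) • volume.restrict (Set.Icc (-1 : ℝ) 1))) := by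
    rw [integrable_map_measure hF.aestronglyMeasurable hm₁.aemeasurable]
    refine Integrable.smul_measure ?_ (by simp)
    exact (continuous_const (y := c + d * 0)).integrableOn_Icc
  have hi₂ : Integrable (fun s : Gex => c + d * s.2.1)
      (Measure.map (fun p : ℂ × ℂ => ((0, p.1, p.2) : Gex)) (discUnif.prod discUnif)) := by
    rw [integrable_map_measure hF.aestronglyMeasurable hm₂.aemeasurable]
    exact hd.comp_fst discUnif
  rw [μex, integral_add_measure (hi₁.smul_measure (by simp)) (hi₂.smul_measure (by simp)),
    integral_smul_measure, integral_smul_measure,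
    integral_map hm₁.aemeasurable hF.aestronglyMeasurable,
    integral_map hm₂.aemeasurable hF.aestronglyMeasurable,
    integral_fun_fst (fun u : ℂ => c + d * u),
    integral_add (integrable_const c) (integrable_id_discUnif.const_mul d),
    integral_const_mul, integral_id_discUnif]
  simp only [mul_zero, add_zero, integral_const, probReal_univ, Complex.real_smul,
    ENNReal.toReal_inv, ENNReal.toReal_ofNat]
  norm_num
  ring

lemma lderivG_pi_smul_fex (c : ℂ) :
    lderivG (Real.pi, 0, 0) (c • fex) = (-2 * c) • fex := by
  funext x
  simp only [lderivG, fex, gmul, Pi.smul_apply, smul_eq_mul, Complex.exp_pi_mul_I]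
  ring

lemma foldr_lderivG_pi_fex (n : ℕ) :
    (List.replicate n ((Real.pi, 0, 0) : Gex)).foldr lderivG fex = ((-2 : ℂ) ^ n) • fex := by
  induction n with
  | zero => simp
  | succ n ih => rw [List.replicate_succ, List.foldr_cons, ih, lderivG_pi_smul_fex, pow_succ, mul_comm]

/-- The function `f(a,(u,v)) = u` on `G = ℝ ⋉ (ℝ² × ℝ²)` is `μ`-harmonic but is not a
polynomial of any degree. -/
theorem stmt17 :
    (∀ x : Gex, fex x = ∫ s, fex (gmul x s) ∂μex) ∧
    (∀ n : ℕ, ∃ us : List Gex, us.length = n + 1 ∧ us.foldr lderivG fex ≠ 0) := by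
  refine ⟨fun x => (integral_affine_μex _ _).symm, fun n =>
    ⟨List.replicate (n + 1) (Real.pi, 0, 0), List.length_replicate, fun h => ?_⟩⟩
  rw [foldr_lderivG_pi_fex] at h
  simpa [fex] using congrFun h (0, 1, 0)
end
end
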